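/- (Uniqueness theorem.) If (X',Y') is a valid ping-pong table, then C' = C or C' = −C, where C is the open cone generated by u = (1,-2,1), v = (1,0,3), w = (0,-1,1). In other words, up to sign, C is the unique simplicial cone in ℝ³ whose associated sets X' = C' ∪ (−C') and Y' = R·X' ∪ R²·X' ∪ R³·X' form a valid ping-pong table for ⟨R⟩ and ⟨T⟩. -/

import Mathlib

open Matrix

/-- The matrix `R`. -/
def R : Matrix (Fin 3) (Fin 3) ℝ := !![0,0,-1; 1,0,-1; 0,1,-1]

/-- The matrix `T`. -/
def T : Matrix (Fin 3) (Fin 3) ℝ := !![-1,0,0; 2,1,0; -4,0,1]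

/-- The open cone generated by three vectors in `ℝ³`. -/
def cone3 (u' v' w' : Fin 3 → ℝ) : Set (Fin 3 → ℝ) :=
  {p | ∃ a b c : ℝ, 0 < a ∧ 0 < b ∧ 0 < c ∧ p = a • u' + b • v' + c • w'}

/-- `X' = C' ∪ (−C')` where `C'` is the open cone generated by `u', v', w'`. -/
def Xset (u' v' w' : Fin 3 → ℝ) : Set (Fin 3 → ℝ) :=
  cone3 u' v' w' ∪ (-(cone3 u' v' w'))

/-- `Y' = R·X' ∪ R²·X' ∪ R³·X'`. -/
def Yset (u' v' w' : Fin 3 → ℝ) : Set (Fin 3 → ℝ) :=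
  R.mulVec '' Xset u' v' w' ∪ (R ^ 2).mulVec '' Xset u' v' w' ∪
    (R ^ 3).mulVec '' Xset u' v' w'

/-- `(X',Y')` is a valid ping-pong table: `X' ∩ Y' = ∅` and `T·Y' ⊆ X'`
(the condition that `R, R², R³` map `X'` into `Y'` holds by construction). -/
def IsValidTable (u' v' w' : Fin 3 → ℝ) : Prop :=
  Xset u' v' w' ∩ Yset u' v' w' = ∅ ∧
    T.mulVec '' Yset u' v' w' ⊆ Xset u' v' w'

/-- A matrix mapping the open positive orthant to plus or minus itself is, up to sign, nonnegative. -/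
lemma pp_sign (M : Matrix (Fin 3) (Fin 3) ℝ)
    (h : ∀ c : Fin 3 → ℝ, (∀ i, 0 < c i) → (∀ i, 0 < (M *ᵥ c) i) ∨ (∀ i, (M *ᵥ c) i < 0)) :
    (∀ i j, 0 ≤ M i j) ∨ (∀ i j, M i j ≤ 0) := by
  have key : (∀ c : Fin 3 → ℝ, (∀ i, 0 < c i) → (∀ i, 0 < (M *ᵥ c) i)) ∨
      (∀ c : Fin 3 → ℝ, (∀ i, 0 < c i) → (∀ i, (M *ᵥ c) i < 0)) := by
    by_contra hcon
    push Not at hcon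
    obtain ⟨⟨c, hc, i, hi⟩, ⟨d, hd, j, hj⟩⟩ := hcon
    have h1 : (M *ᵥ c) 0 < 0 := by
      rcases h c hc with h' | h'
      · exact absurd (h' i) (not_lt.mpr hi)
      · exact h' 0
    have h2 : 0 < (M *ᵥ d) 0 := by
      rcases h d hd with h' | h'
      · exact h' 0
      · exact absurd (h' j) (not_lt.mpr hj)
    have h3 := h ((M *ᵥ d) 0 • c + (-(M *ᵥ c) 0) • d) (by
      intro l
      have := hc l
      have := hd l
      have h1' : 0 < -(M *ᵥ c) 0 := by linarith
      simp only [Pi.add_apply, Pi.smul_apply, smul_eq_mul]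
      positivity)
    have h4 : (M *ᵥ ((M *ᵥ d) 0 • c + (-(M *ᵥ c) 0) • d)) 0 = 0 := by
      rw [Matrix.mulVec_add, Matrix.mulVec_smul, Matrix.mulVec_smul]
      simp only [Pi.add_apply, Pi.smul_apply, smul_eq_mul]
      ring
    rcases h3 with h3 | h3
    · have := h3 0; linarith
    · have := h3 0; linarith
  have lim : ∀ (N : Matrix (Fin 3) (Fin 3) ℝ),
      (∀ c : Fin 3 → ℝ, (∀ i, 0 < c i) → (∀ i, 0 < (N *ᵥ c) i)) → ∀ i j, 0 ≤ N i j := by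
    intro N hN i j
    by_contra hneg
    push Not at hneg
    have h1 := hN (fun _ => 1) (by intro; norm_num) i
    set S := (N *ᵥ (fun _ => (1:ℝ))) i with hS
    have h2 := hN (Pi.single j 1 + (-N i j / S) • (fun _ => (1:ℝ))) (by
      intro l
      have hp : 0 < -N i j / S := div_pos (by linarith) h1
      have h0 : 0 ≤ (Pi.single j (1:ℝ) : Fin 3 → ℝ) l := by
        by_cases hl : l = j
        · subst hl; simp
        · simp [hl]
      simp only [Pi.add_apply, Pi.smul_apply, smul_eq_mul]
      linarith) i
    rw [Matrix.mulVec_add, Matrix.mulVec_smul] at h2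
    simp only [Pi.add_apply, Pi.smul_apply, smul_eq_mul, ← hS, Matrix.mulVec_single_one,
      Matrix.col_apply] at h2
    rw [div_mul_cancel₀ _ h1.ne'] at h2
    linarith
  rcases key with key | key
  · exact Or.inl (lim M key)
  · right
    intro i j
    have := lim (-M) (by
      intro c hc i
      rw [Matrix.neg_mulVec]
      simpa using key c hc i) i j
    simpa using this

/-- A nonnegative unipotent 3×3 matrix with one Jordan block is triangular up to permutation. -/
lemma pp_tri (M : Matrix (Fin 3) (Fin 3) ℝ) (hM : ∀ i j, 0 ≤ M i j)
    (h1 : M.trace = 3) (h2 : (M * M).trace = 3) (h3 : M.det = 1)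
    (h4 : (M - 1) * (M - 1) ≠ 0) :
    ∃ i j, i ≠ j ∧ ∃ m : ℝ, 0 < m ∧ (∀ l, M l i = (Pi.single i 1 : Fin 3 → ℝ) l) ∧
      (∀ l, M l j = (Pi.single j 1 + m • Pi.single i 1 : Fin 3 → ℝ) l) := by
  simp only [Matrix.trace_fin_three, Matrix.mul_apply, Fin.sum_univ_three] at h1 h2
  rw [Matrix.det_fin_three] at h3
  have p01 := mul_nonneg (hM 0 1) (hM 1 0)
  have p02 := mul_nonneg (hM 0 2) (hM 2 0)
  have p12 := mul_nonneg (hM 1 2) (hM 2 1)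
  have hsq : (M 0 0 - 1)^2 + (M 1 1 - 1)^2 + (M 2 2 - 1)^2 + 2 * (M 0 1 * M 1 0)
      + 2 * (M 0 2 * M 2 0) + 2 * (M 1 2 * M 2 1) = 0 := by linarith
  have s0 := sq_nonneg (M 0 0 - 1)
  have s1 := sq_nonneg (M 1 1 - 1)
  have s2 := sq_nonneg (M 2 2 - 1)
  have d0 : M 0 0 = 1 := by
    have : (M 0 0 - 1)^2 = 0 := by linarith
    have := pow_eq_zero_iff (two_ne_zero) |>.mp this
    linarith
  have d1 : M 1 1 = 1 := by
    have : (M 1 1 - 1)^2 = 0 := by linarith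
    have := pow_eq_zero_iff (two_ne_zero) |>.mp this
    linarith
  have d2 : M 2 2 = 1 := by
    have : (M 2 2 - 1)^2 = 0 := by linarith
    have := pow_eq_zero_iff (two_ne_zero) |>.mp this
    linarith
  have q01 : M 0 1 * M 1 0 = 0 := by linarith
  have q02 : M 0 2 * M 2 0 = 0 := by linarith
  have q12 : M 1 2 * M 2 1 = 0 := by linarith
  have c1 := mul_nonneg (mul_nonneg (hM 0 1) (hM 1 2)) (hM 2 0)
  have c2 := mul_nonneg (mul_nonneg (hM 0 2) (hM 1 0)) (hM 2 1)
  rw [d0, d1, d2] at h3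
  have e1 : M 0 1 * M 1 2 * M 2 0 = 0 := by linarith
  have e2 : M 0 2 * M 1 0 * M 2 1 = 0 := by linarith
  -- pick the nonzero path
  have hex : ∃ i j k, 0 < M i j ∧ 0 < M j k ∧ i ≠ j ∧ j ≠ k ∧ i ≠ k := by
    by_contra hcon
    push Not at hcon
    have z : ∀ i j k, i ≠ j → j ≠ k → i ≠ k → M i j * M j k = 0 := by
      intro i j k hij hjk hik
      rcases (hM i j).eq_or_lt with h | h
      · rw [← h, zero_mul]
      · rcases (hM j k).eq_or_lt with h' | h'
        · rw [← h', mul_zero]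
        · exact absurd (hcon i j k h h' hij hjk) hik
    have z012 := z 0 1 2 (by decide) (by decide) (by decide)
    have z021 := z 0 2 1 (by decide) (by decide) (by decide)
    have z102 := z 1 0 2 (by decide) (by decide) (by decide)
    have z120 := z 1 2 0 (by decide) (by decide) (by decide)
    have z201 := z 2 0 1 (by decide) (by decide) (by decide)
    have z210 := z 2 1 0 (by decide) (by decide) (by decide)
    apply h4
    ext i j
    fin_cases i <;> fin_cases j <;>
      simp [Matrix.mul_apply, Fin.sum_univ_three, d0, d1, d2] <;> grind
  obtain ⟨i, j, k, hij, hjk, nij, njk, nik⟩ := hex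
  have diag : ∀ i, M i i = 1 := by intro i; fin_cases i <;> assumption
  have two : ∀ i j, i ≠ j → M i j * M j i = 0 := by
    intro i j h; fin_cases i <;> fin_cases j <;> simp at h ⊢ <;> grind
  have three : ∀ i j k, i ≠ j → j ≠ k → i ≠ k → M i j * M j k * M k i = 0 := by
    intro i j k h h' hac
    fin_cases i <;> fin_cases j <;> fin_cases k <;> simp at h h' hac ⊢ <;> grind
  have zji : M j i = 0 := by
    rcases mul_eq_zero.mp (two i j nij) with h | h
    · exact absurd h hij.ne'
    · exact h
  have zkj : M k j = 0 := by
    rcases mul_eq_zero.mp (two j k njk) with h | h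
    · exact absurd h hjk.ne'
    · exact h
  have zki : M k i = 0 := by
    rcases mul_eq_zero.mp (three i j k nij njk nik) with h | h
    · exact absurd h (mul_pos hij hjk).ne'
    · exact h
  have all : ∀ l, l = i ∨ l = j ∨ l = k := by
    intro l; revert nij njk nik; clear * -; revert i j k l; decide
  refine ⟨i, j, nij, M i j, hij, ?_, ?_⟩
  · intro l
    rcases all l with rfl | rfl | rfl
    · simp [diag]
    · simp [zji, nij.symm]
    · simp [zki, nik.symm]
  · intro l
    rcases all l with rfl | rfl | rfl
    · simp [nij]
    · simp [diag, nij.symm]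
    · simp [zkj, nik.symm, njk.symm]

lemma pp_key (A : Matrix (Fin 3) (Fin 3) ℝ) (e : Fin 3 → Fin 3 → ℝ)
    (he : LinearIndependent ℝ e)
    (hA : ∀ p ∈ Xset (e 0) (e 1) (e 2), A *ᵥ p ∈ Xset (e 0) (e 1) (e 2))
    (h1 : A.trace = 3) (h2 : (A * A).trace = 3) (h3 : A.det = 1)
    (h4 : (A - 1) * (A - 1) ≠ 0) :
    ∃ i j, i ≠ j ∧ ∃ m : ℝ, 0 < m ∧ A *ᵥ e i = e i ∧ A *ᵥ e j = e j + m • e i := by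
  set P : Matrix (Fin 3) (Fin 3) ℝ := (Matrix.of e)ᵀ with hP
  have hPc : ∀ c, P *ᵥ c = c 0 • e 0 + c 1 • e 1 + c 2 • e 2 := by
    intro c
    ext i
    simp [hP, Matrix.mulVec, dotProduct, Fin.sum_univ_three]
    ring
  have hPs : ∀ i, P *ᵥ Pi.single i 1 = e i := by
    intro i
    rw [Matrix.mulVec_single_one]; rfl
  have hu : IsUnit P := by
    rw [hP, Matrix.isUnit_transpose]
    exact Matrix.linearIndependent_rows_iff_isUnit.mp he
  have hud : IsUnit P.det := (Matrix.isUnit_iff_isUnit_det P).mp hu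
  have hPP : P * P⁻¹ = 1 := Matrix.mul_nonsing_inv P hud
  have hPP' : P⁻¹ * P = 1 := Matrix.nonsing_inv_mul P hud
  set M := P⁻¹ * A * P with hM
  have hPM : P * M = A * P := by rw [hM, ← mul_assoc, ← mul_assoc, hPP, one_mul]
  have hAM : A = P * M * P⁻¹ := by rw [hPM, mul_assoc, hPP, mul_one]
  have hMc : ∀ c, A *ᵥ (P *ᵥ c) = P *ᵥ (M *ᵥ c) := by
    intro c; rw [Matrix.mulVec_mulVec, Matrix.mulVec_mulVec, hPM]
  have hinj : ∀ c d, P *ᵥ c = P *ᵥ d → c = d := fun c d h =>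
    Matrix.mulVec_injective_of_isUnit hu h
  have hX : ∀ c, P *ᵥ c ∈ Xset (e 0) (e 1) (e 2) → (∀ i, 0 < c i) ∨ (∀ i, c i < 0) := by
    intro c hc
    rcases hc with ⟨x, y, z, hx, hy, hz, h⟩ | ⟨x, y, z, hx, hy, hz, h⟩
    · left
      have : c = ![x, y, z] := by
        apply hinj; rw [h, hPc]; rfl
      intro i; rw [this]; fin_cases i <;> simpa
    · right
      have : -c = ![x, y, z] := by
        apply hinj; rw [Matrix.mulVec_neg, h, hPc]; rfl
      intro i
      have h' := congrFun this i
      fin_cases i <;> simp at h' ⊢ <;> linarith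
  have hsign := pp_sign M (by
    intro c hc
    apply hX
    rw [← hMc]
    apply hA
    left
    exact ⟨c 0, c 1, c 2, hc 0, hc 1, hc 2, hPc c⟩)
  have t1 : M.trace = 3 := by
    rw [← h1, hM, mul_assoc, Matrix.trace_mul_comm, mul_assoc, hPP, mul_one]
  have hMM : M * M = P⁻¹ * (A * A) * P := by
    calc M * M = P⁻¹ * A * (P * P⁻¹) * A * P := by rw [hM]; simp only [mul_assoc]
      _ = _ := by rw [hPP, mul_one]; simp only [mul_assoc]
  have t2 : (M * M).trace = 3 := by
    rw [← h2, hMM, mul_assoc, Matrix.trace_mul_comm, mul_assoc, hPP, mul_one]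
  have t3 : M.det = 1 := by
    have := congrArg Matrix.det hPM
    rw [Matrix.det_mul P M, Matrix.det_mul A P, h3, one_mul] at this
    exact mul_left_cancel₀ hud.ne_zero (by rw [this, mul_one])
  have hM1 : A - 1 = P * (M - 1) * P⁻¹ := by
    rw [mul_sub, sub_mul, ← hAM, mul_one, hPP]
  have t4 : (M - 1) * (M - 1) ≠ 0 := by
    intro h
    apply h4
    calc (A - 1) * (A - 1) = P * (M - 1) * (P⁻¹ * P) * (M - 1) * P⁻¹ := by
          rw [hM1]; simp only [mul_assoc]
      _ = P * ((M - 1) * (M - 1)) * P⁻¹ := by rw [hPP', mul_one]; simp only [mul_assoc]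
      _ = 0 := by rw [h]; simp
  have hpos : ∀ i j, 0 ≤ M i j := by
    rcases hsign with h | h
    · exact h
    · exfalso
      rw [Matrix.trace_fin_three] at t1
      linarith [h 0 0, h 1 1, h 2 2]
  obtain ⟨i, j, hij, m, hm, hi, hj⟩ := pp_tri M hpos t1 t2 t3 t4
  refine ⟨i, j, hij, m, hm, ?_, ?_⟩
  · rw [← hPs i, hMc]
    congr 1
    ext l
    rw [Matrix.mulVec_single_one]; exact hi l
  · rw [← hPs i, ← hPs j, hMc, ← Matrix.mulVec_smul, ← Matrix.mulVec_add]
    congr 1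
    ext l
    rw [Matrix.mulVec_single_one]; exact hj l

lemma pp_swap12 (a b c : Fin 3 → ℝ) : cone3 a b c = cone3 b a c := by
  ext p
  constructor <;> rintro ⟨x, y, z, hx, hy, hz, rfl⟩ <;>
    exact ⟨y, x, z, hy, hx, hz, by abel⟩

lemma pp_swap23 (a b c : Fin 3 → ℝ) : cone3 a b c = cone3 a c b := by
  ext p
  constructor <;> rintro ⟨x, y, z, hx, hy, hz, rfl⟩ <;>
    exact ⟨x, z, y, hx, hz, hy, by abel⟩

lemma pp_scale (a b c : Fin 3 → ℝ) (r s t : ℝ) (hr : 0 < r) (hs : 0 < s) (ht : 0 < t) :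
    cone3 (r • a) (s • b) (t • c) = cone3 a b c := by
  ext p
  constructor
  · rintro ⟨x, y, z, hx, hy, hz, rfl⟩
    exact ⟨x * r, y * s, z * t, by positivity, by positivity, by positivity, by
      simp only [smul_smul]⟩
  · rintro ⟨x, y, z, hx, hy, hz, rfl⟩
    refine ⟨x / r, y / s, z / t, by positivity, by positivity, by positivity, ?_⟩
    simp only [smul_smul]
    rw [div_mul_cancel₀ _ hr.ne', div_mul_cancel₀ _ hs.ne', div_mul_cancel₀ _ ht.ne']

lemma pp_neg (a b c : Fin 3 → ℝ) : cone3 (-a) (-b) (-c) = -cone3 a b c := by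
  ext p
  constructor
  · rintro ⟨x, y, z, hx, hy, hz, rfl⟩
    exact ⟨x, y, z, hx, hy, hz, by simp; abel⟩
  · rintro ⟨x, y, z, hx, hy, hz, h⟩
    refine ⟨x, y, z, hx, hy, hz, ?_⟩
    rw [← neg_neg p, h]; simp; abel

lemma pp_perm (e : Fin 3 → Fin 3 → ℝ) (i j k : Fin 3) (hij : i ≠ j) (hik : i ≠ k) (hjk : j ≠ k) :
    cone3 (e 0) (e 1) (e 2) = cone3 (e i) (e j) (e k) := by
  fin_cases i <;> fin_cases j <;> fin_cases k <;> simp at hij hik hjk ⊢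
  · exact pp_swap23 _ _ _
  · exact pp_swap12 _ _ _
  · rw [pp_swap12, pp_swap23]
  · rw [pp_swap23, pp_swap12]
  · rw [pp_swap12, pp_swap23, pp_swap12]

lemma pp_A1 : T * R = !![0,0,1; 1,0,-3; 0,1,3] := by
  ext i j
  fin_cases i <;> fin_cases j <;> simp [T, R, Matrix.mul_apply, Fin.sum_univ_three] <;> norm_num

lemma pp_A3 : T * R ^ 3 = !![1,-1,0; -3,2,1; 3,-4,0] := by
  rw [pow_succ, pow_two]
  ext i j
  fin_cases i <;> fin_cases j <;> simp [T, R, Matrix.mul_apply, Fin.sum_univ_three] <;> norm_num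

/-- Uniqueness theorem: if `(X',Y')` is a valid ping-pong table, then
`C' = C` or `C' = −C`, where `C` is the open cone generated by
`u = (1,-2,1)`, `v = (1,0,3)`, `w = (0,-1,1)`. -/
theorem cone_uniqueness (u' v' w' : Fin 3 → ℝ)
    (hind : LinearIndependent ℝ ![u', v', w'])
    (hvalid : IsValidTable u' v' w') :
    cone3 u' v' w' = cone3 ![1,-2,1] ![1,0,3] ![0,-1,1] ∨
    cone3 u' v' w' = -(cone3 ![1,-2,1] ![1,0,3] ![0,-1,1]) := by
  obtain ⟨-, hT⟩ := hvalid
  have H1 : ∀ p ∈ Xset u' v' w', (T * R) *ᵥ p ∈ Xset u' v' w' := by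
    intro p hp
    rw [← Matrix.mulVec_mulVec]
    exact hT ⟨_, Or.inl (Or.inl ⟨p, hp, rfl⟩), rfl⟩
  have H3 : ∀ p ∈ Xset u' v' w', (T * R ^ 3) *ᵥ p ∈ Xset u' v' w' := by
    intro p hp
    rw [← Matrix.mulVec_mulVec]
    exact hT ⟨_, Or.inr ⟨p, hp, rfl⟩, rfl⟩
  rw [pp_A1] at H1
  rw [pp_A3] at H3
  have hcone : cone3 u' v' w' =
    cone3 ((![u', v', w']) 0) ((![u', v', w']) 1) ((![u', v', w']) 2) := rfl
  rw [hcone]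
  have K1 := pp_key _ ![u', v', w'] hind H1
    (by simp [Matrix.trace_fin_three])
    (by simp [Matrix.trace_fin_three, Matrix.mul_apply, Fin.sum_univ_three]; norm_num)
    (by simp [Matrix.det_fin_three])
    (by
      intro h
      have := congrFun (congrFun h 0) 0
      simp [Matrix.mul_apply, Fin.sum_univ_three] at this)
  have K3 := pp_key _ ![u', v', w'] hind H3
    (by simp [Matrix.trace_fin_three]; try norm_num)
    (by simp [Matrix.trace_fin_three, Matrix.mul_apply, Fin.sum_univ_three]; norm_num)
    (by simp [Matrix.det_fin_three]; try norm_num)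
    (by
      intro h
      have := congrFun (congrFun h 0) 0
      simp [Matrix.mul_apply, Fin.sum_univ_three] at this)
  have hne : ∀ i, ![u', v', w'] i ≠ 0 := fun i => hind.ne_zero i
  clear hcone H1 H3 hT hind
  generalize ![u', v', w'] = e at *
  obtain ⟨i, j, hij, m, hm, hi, hj⟩ := K1
  obtain ⟨k, l, hkl, n, hn, hk, hl⟩ := K3
  have i0 := congrFun hi 0
  have i1 := congrFun hi 1
  have i2 := congrFun hi 2
  have j0 := congrFun hj 0
  have j1 := congrFun hj 1
  have j2 := congrFun hj 2
  have k0 := congrFun hk 0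
  have k1 := congrFun hk 1
  have k2 := congrFun hk 2
  have l0 := congrFun hl 0
  have l1 := congrFun hl 1
  have l2 := congrFun hl 2
  simp [Matrix.mulVec, dotProduct, Fin.sum_univ_three] at i0 i1 i2 j0 j1 j2 k0 k1 k2 l0 l1 l2
  have hei : e i = e i 0 • ![1,-2,1] := by
    ext x; fin_cases x <;> simp <;> linarith
  have hek : e k = e k 0 • ![1,0,3] := by
    ext x; fin_cases x <;> simp <;> linarith
  have hi0 : e i 0 ≠ 0 := fun h => hne i (by rw [hei, h, zero_smul])
  have hk0 : e k 0 ≠ 0 := fun h => hne k (by rw [hek, h, zero_smul])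
  have mi : m * e i 0 ≠ 0 := mul_ne_zero hm.ne' hi0
  have nk : n * e k 0 ≠ 0 := mul_ne_zero hn.ne' hk0
  have ei1 : e i 1 = -2 * e i 0 := by linarith
  have ei2 : e i 2 = e i 0 := by linarith
  have ek1 : e k 1 = 0 := by linarith
  have ek2 : e k 2 = 3 * e k 0 := by linarith
  rw [ei1] at j1
  rw [ei2] at j2
  rw [ek1] at l1
  rw [ek2] at l2
  have hik : i ≠ k := by
    rintro rfl
    apply hi0; linarith
  have hjk : j ≠ k := by
    rintro rfl
    apply hk0; linarith
  have hil : i ≠ l := by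
    rintro rfl
    apply hi0; linarith
  have hjl : l = j := by
    clear * - hij hkl hik hjk hil; omega
  subst hjl
  have hel : e l = (m * e i 0) • ![0,-1,1] := by
    ext x; fin_cases x <;> simp <;> linarith
  have hmn : m * e i 0 = n * e k 0 := by linarith
  rw [pp_perm e i k l hik hij hkl]
  rcases lt_or_gt_of_ne hi0 with hs | hs
  · right
    have hs2 : m * e i 0 < 0 := mul_neg_of_pos_of_neg hm hs
    have hs3 : e k 0 < 0 := by
      by_contra hcon
      push Not at hcon
      have := mul_nonneg hn.le hcon
      linarith
    rw [← pp_neg, hei, hek, hel,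
      ← pp_scale (-_) (-_) (-_) (-(e i 0)) (-(e k 0)) (-(m * e i 0)) (by linarith) (by linarith)
        (by linarith)]
    simp only [smul_neg, neg_smul, neg_neg]
  · left
    have hs2 : 0 < m * e i 0 := mul_pos hm hs
    have hs3 : 0 < e k 0 := by
      by_contra hcon
      push Not at hcon
      have := mul_nonpos_of_nonneg_of_nonpos hn.le hcon
      linarith
    rw [hei, hek, hel]
    simpa using pp_scale ![1,-2,1] ![1,0,3] ![0,-1,1] _ _ _ hs hs3 hs2
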